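/- arXiv:1611.01306 — 3 statements merged into one kernel-verified Lean document; each statement's English description precedes it below -/
import Mathlib

section
/- Let n be a positive integer and let (X_1,…,X_n) ~ Dir(1,…,1). Let J be a random index in {1,…,n} whose conditional distribution given (X_1,…,X_n) satisfies P(J = j | X_1,…,X_n) = X_j. Then: (i) P(J = j) = 1/n for every j; (ii) conditioned on the event {J = j}, the vector (X_1,…,X_n) has the Dirichlet distribution Dir(1,…,1,2,1,…,1) with parameter 2 in the j-th coordinate and 1 elsewhere; (iii) if U ~ Uniform(0,1) is independent of (X_1,…,X_n) and J, then conditioned on {J = j}, the (n+1)-dimensional vector (X_1,…,X_{j−1}, U·X_j, (1−U)·X_j, X_{j+1},…,X_n) has the Dirichlet distribution Dir(1,…,1) with n+1 parameters equal to 1. -/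
open MeasureTheory ProbabilityTheory Real
open scoped ENNReal NNReal

/-- The Dirichlet distribution `Dir(a₁,…,aₙ)`: the law of `(G₁/S,…,Gₙ/S)` where the `Gᵢ` are
independent `Gamma(aᵢ,1)` random variables and `S = G₁ + ⋯ + Gₙ`. -/
noncomputable def dirichletMeasure {n : ℕ} (a : Fin n → ℝ) : Measure (Fin n → ℝ) :=
  Measure.map (fun g i => g i / ∑ j, g j) (Measure.pi fun i => gammaMeasure (a i) 1)

theorem lintegral_pi_fin_prod {n : ℕ} {α : Fin n → Type*} [∀ i, MeasurableSpace (α i)]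
    (μ : ∀ i, Measure (α i)) [∀ i, SigmaFinite (μ i)] {f : ∀ i, α i → ℝ≥0∞}
    (hf : ∀ i, Measurable (f i)) :
    ∫⁻ x, ∏ i, f i (x i) ∂(Measure.pi μ) = ∏ i, ∫⁻ x, f i x ∂(μ i) := by
  induction n with
  | zero => simp
  | succ n ih =>
    have h := (measurePreserving_piFinSuccAbove μ 0).symm
    have hm : Measurable fun x : ∀ i, α ((0 : Fin (n + 1)).succAbove i) =>
        ∏ i, f ((0 : Fin (n + 1)).succAbove i) (x i) :=
      Finset.measurable_prod _ fun i _ => (hf _).comp (measurable_pi_apply i)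
    rw [← h.lintegral_comp_emb (MeasurableEquiv.measurableEmbedding _),
      Fin.prod_univ_succAbove _ 0,
      ← ih (fun i => μ ((0 : Fin (n + 1)).succAbove i)) (fun i => hf _),
      ← lintegral_prod_mul (hf 0).aemeasurable hm.aemeasurable]
    refine lintegral_congr fun x => ?_
    rw [Fin.prod_univ_succAbove _ 0]
    change f 0 (Fin.insertNth 0 x.1 x.2 0) *
      ∏ i, f _ (Fin.insertNth 0 x.1 x.2 ((0 : Fin (n + 1)).succAbove i)) = _
    simp only [Fin.insertNth_apply_same, Fin.insertNth_apply_succAbove]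

theorem pi_withDensity_fin {n : ℕ} {α : Fin n → Type*} [∀ i, MeasurableSpace (α i)]
    (μ : ∀ i, Measure (α i)) [∀ i, SigmaFinite (μ i)] {f : ∀ i, α i → ℝ≥0∞}
    (hf : ∀ i, Measurable (f i)) [∀ i, SigmaFinite ((μ i).withDensity (f i))] :
    Measure.pi (fun i => (μ i).withDensity (f i)) =
      (Measure.pi μ).withDensity (fun x => ∏ i, f i (x i)) := by
  refine Measure.pi_eq fun s hs => ?_
  rw [withDensity_apply _ (MeasurableSet.univ_pi hs),
    ← lintegral_indicator (MeasurableSet.univ_pi hs)]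
  simp_rw [fun i => withDensity_apply (f i) (hs i), ← fun i => lintegral_indicator (hs i) (f i)]
  rw [← lintegral_pi_fin_prod μ fun i => (hf i).indicator (hs i)]
  refine lintegral_congr fun x => ?_
  by_cases hx : x ∈ Set.univ.pi s
  · rw [Set.indicator_of_mem hx]
    exact Finset.prod_congr rfl fun i _ => (Set.indicator_of_mem (hx i trivial) _).symm
  · rw [Set.indicator_of_notMem hx]
    obtain ⟨i, hi⟩ : ∃ i, x i ∉ s i := by simpa using hx
    exact (Finset.prod_eq_zero (Finset.mem_univ i) (Set.indicator_of_notMem hi _)).symm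

instance isProbabilityMeasure_gammaMeasure_one_one : IsProbabilityMeasure (gammaMeasure 1 1) :=
  isProbabilityMeasure_gammaMeasure one_pos one_pos

theorem measurable_gammaPDF (a r : ℝ) : Measurable (gammaPDF a r) :=
  (measurable_gammaPDFReal a r).ennreal_ofReal

theorem gammaPDF_one_one (x : ℝ) :
    gammaPDF 1 1 x = if 0 ≤ x then ENNReal.ofReal (exp (-x)) else 0 := by
  rw [gammaPDF_eq]
  split_ifs <;> simp

theorem gammaMeasure_two_one :
    gammaMeasure 2 1 = (gammaMeasure 1 1).withDensity ENNReal.ofReal := by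
  rw [gammaMeasure, gammaMeasure,
    ← withDensity_mul _ (measurable_gammaPDF 1 1) ENNReal.measurable_ofReal]
  congr 1
  ext x
  rcases lt_or_ge x 0 with hx | hx
  · simp [gammaPDF_of_neg hx]
  · rw [Pi.mul_apply, gammaPDF_one_one, gammaPDF_of_nonneg hx, if_pos hx,
      ← ENNReal.ofReal_mul (exp_pos _).le]
    congr 1
    norm_num
    ring

theorem isProbabilityMeasure_gammaMeasure_update {n : ℕ} (j i : Fin n) :
    IsProbabilityMeasure (gammaMeasure (Function.update (fun _ : Fin n => (1:ℝ)) j 2 i) 1) := by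
  refine isProbabilityMeasure_gammaMeasure ?_ one_pos
  rcases eq_or_ne i j with rfl | hi <;> simp [*]

theorem pi_gammaMeasure_update_two {n : ℕ} (j : Fin n) :
    Measure.pi (fun i => gammaMeasure (Function.update (fun _ : Fin n => (1:ℝ)) j 2 i) 1) =
      (Measure.pi fun _ : Fin n => gammaMeasure 1 1).withDensity
        (fun g => ENNReal.ofReal (g j)) := by
  have h : ∀ i, gammaMeasure (Function.update (fun _ : Fin n => (1:ℝ)) j 2 i) 1 =
      (gammaMeasure 1 1).withDensity (Function.update (fun _ : Fin n => (1 : ℝ → ℝ≥0∞)) j ENNReal.ofReal i) := by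
    intro i
    rcases eq_or_ne i j with rfl | hi
    · simp [gammaMeasure_two_one]
    · simp [hi]
  have hprob := isProbabilityMeasure_gammaMeasure_update j
  simp_rw [h] at hprob ⊢
  rw [pi_withDensity_fin]
  · congr 1
    ext g
    rw [Finset.prod_eq_single j] <;> simp +contextual
  · intro i
    rcases eq_or_ne i j with rfl | hi
    · simpa using ENNReal.measurable_ofReal
    · simpa [hi] using measurable_one

theorem pi_gammaMeasure_one {n : ℕ} :
    Measure.pi (fun _ : Fin n => gammaMeasure 1 1) =
      volume.withDensity (fun g => ∏ i, gammaPDF 1 1 (g i)) := by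
  have : SigmaFinite ((volume : Measure ℝ).withDensity (gammaPDF 1 1)) :=
    inferInstanceAs (SigmaFinite (gammaMeasure 1 1))
  exact pi_withDensity_fin (fun _ => volume) fun _ => measurable_gammaPDF 1 1

theorem lintegral_comp_smul_pi {n : ℕ} (h : (Fin n → ℝ) → ℝ≥0∞) (hh : Measurable h) {t : ℝ}
    (ht : 0 < t) :
    ∫⁻ g, h (t • g) = ENNReal.ofReal ((t ^ n)⁻¹) * ∫⁻ g, h g := by
  rw [← lintegral_map hh (measurable_const_smul t), Measure.map_addHaar_smul _ ht.ne',
    lintegral_smul_measure]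
  simp [abs_of_pos ht]

theorem prod_gammaPDF_one_one_of_nonneg {n : ℕ} {g : Fin n → ℝ} (hg : ∀ i, 0 ≤ g i) :
    ∏ i, gammaPDF 1 1 (g i) = ENNReal.ofReal (exp (-∑ i, g i)) := by
  simp_rw [gammaPDF_one_one, if_pos (hg _), ← Finset.sum_neg_distrib, exp_sum]
  rw [ENNReal.ofReal_prod_of_nonneg fun i _ => (exp_pos _).le]

theorem lintegral_Ioi_prod_gammaPDF_smul {n : ℕ} {g : Fin n → ℝ}
    (hg : (∀ i, 0 ≤ g i) → 0 < ∑ i, g i) :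
    ∫⁻ t in Set.Ioi (1:ℝ), ∏ i, gammaPDF 1 1 ((t • g) i) =
      (∏ i, gammaPDF 1 1 (g i)) * (ENNReal.ofReal (∑ i, g i))⁻¹ := by
  by_cases h : ∀ i, 0 ≤ g i
  · replace hg := hg h
    have h1 : ∫⁻ t in Set.Ioi (1:ℝ), ∏ i, gammaPDF 1 1 ((t • g) i) =
        ∫⁻ t in Set.Ioi (1:ℝ), ENNReal.ofReal (exp ((-∑ i, g i) * t)) := by
      refine setLIntegral_congr_fun measurableSet_Ioi fun t ht => ?_
      have ht0 : (0:ℝ) ≤ t := (zero_le_one.trans (le_of_lt ht))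
      rw [prod_gammaPDF_one_one_of_nonneg (g := t • g) fun i => mul_nonneg ht0 (h i)]
      simp [← Finset.mul_sum, mul_comm]
    have hneg : -∑ i, g i < 0 := by linarith
    rw [h1, ← ofReal_integral_eq_lintegral_ofReal (integrableOn_exp_mul_Ioi hneg 1)
      (ae_of_all _ fun _ => (exp_pos _).le), integral_exp_mul_Ioi hneg,
      prod_gammaPDF_one_one_of_nonneg h, ← ENNReal.ofReal_inv_of_pos hg,
      ← ENNReal.ofReal_mul (exp_pos _).le]
    simp [div_eq_mul_inv]
  · push Not at h
    obtain ⟨i, hi⟩ := h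
    rw [Finset.prod_eq_zero (Finset.mem_univ i) (gammaPDF_of_neg hi), zero_mul]
    refine (setLIntegral_congr_fun measurableSet_Ioi fun t ht => ?_).trans lintegral_zero
    have ht0 : (0:ℝ) < t := (zero_lt_one.trans ht)
    exact Finset.prod_eq_zero (Finset.mem_univ i)
      (gammaPDF_of_neg (by simpa using mul_neg_of_pos_of_neg ht0 hi))

theorem lintegral_Ioi_inv_pow {n : ℕ} (hn : 0 < n) :
    ∫⁻ t in Set.Ioi (1:ℝ), ENNReal.ofReal (t⁻¹ * (t ^ n)⁻¹) = (n : ℝ≥0∞)⁻¹ := by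
  have hn' : (0:ℝ) < n := by exact_mod_cast hn
  have ha : -(n + 1 : ℝ) < -1 := by linarith
  have h1 : ∫⁻ t in Set.Ioi (1:ℝ), ENNReal.ofReal (t⁻¹ * (t ^ n)⁻¹) =
      ∫⁻ t in Set.Ioi (1:ℝ), ENNReal.ofReal (t ^ (-(n + 1 : ℝ))) := by
    refine setLIntegral_congr_fun measurableSet_Ioi fun t ht => ?_
    have ht0 : (0:ℝ) < t := zero_lt_one.trans ht
    rw [rpow_neg ht0.le, rpow_add_one ht0.ne', rpow_natCast, mul_inv, mul_comm]
  rw [h1, ← ofReal_integral_eq_lintegral_ofReal (integrableOn_Ioi_rpow_of_lt ha one_pos),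
    integral_Ioi_rpow_of_lt ha one_pos]
  · rw [one_rpow, ← ENNReal.ofReal_natCast, ← ENNReal.ofReal_inv_of_pos hn']
    congr 1
    rw [neg_add, neg_add_cancel_right, neg_div_neg_eq, one_div]
  · exact (ae_restrict_iff' measurableSet_Ioi).2 <| ae_of_all _ fun t ht =>
      rpow_nonneg (zero_le_one.trans (le_of_lt ht)) _

theorem ae_pos_gammaMeasure_one_one : ∀ᵐ x ∂(gammaMeasure 1 1), 0 < x := by
  rw [gammaMeasure, ae_withDensity_iff (measurable_gammaPDF 1 1)]
  filter_upwards [Measure.ae_ne volume (0:ℝ)] with x hx h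
  by_contra hle
  exact h (gammaPDF_of_neg (lt_of_le_of_ne (not_lt.1 hle) hx))

theorem ae_pos_pi_gammaMeasure_one {n : ℕ} :
    ∀ᵐ g ∂(Measure.pi fun _ : Fin n => gammaMeasure 1 1), ∀ i, 0 < g i :=
  ae_all_iff.2 fun i => (Measure.quasiMeasurePreserving_eval _ i).ae ae_pos_gammaMeasure_one_one

theorem lintegral_div_sum_of_homogeneous {n : ℕ} (hn : 0 < n) {F : (Fin n → ℝ) → ℝ≥0∞}
    (hF : Measurable F)
    (hhom : ∀ (t : ℝ) (g : Fin n → ℝ), 0 < t → F (t • g) = ENNReal.ofReal t * F g) :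
    ∫⁻ g, F g * (ENNReal.ofReal (∑ i, g i))⁻¹ ∂(Measure.pi fun _ : Fin n => gammaMeasure 1 1) =
      (n : ℝ≥0∞)⁻¹ * ∫⁻ g, F g ∂(Measure.pi fun _ : Fin n => gammaMeasure 1 1) := by
  have hw : Measurable fun g : Fin n → ℝ => ∏ i, gammaPDF 1 1 (g i) :=
    Finset.measurable_prod _ fun i _ => (measurable_gammaPDF 1 1).comp (measurable_pi_apply i)
  have hws : Measurable fun q : (Fin n → ℝ) × ℝ => ∏ i, gammaPDF 1 1 ((q.2 • q.1) i) :=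
    hw.comp (measurable_snd.smul measurable_fst)
  have hS : Measurable fun g : Fin n → ℝ => (ENNReal.ofReal (∑ i, g i))⁻¹ := by fun_prop
  have : Nonempty (Fin n) := ⟨⟨0, hn⟩⟩
  have hne : ∀ᵐ g : Fin n → ℝ, ∀ i, g i ≠ 0 := ae_all_iff.2 fun i =>
    (Measure.quasiMeasurePreserving_eval (fun _ : Fin n => (volume : Measure ℝ)) i).ae
      (Measure.ae_ne volume (0:ℝ))
  have hFS : Measurable fun g => F g * (ENNReal.ofReal (∑ i, g i))⁻¹ := hF.mul hS
  rw [pi_gammaMeasure_one, lintegral_withDensity_eq_lintegral_mul _ hw hFS,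
    lintegral_withDensity_eq_lintegral_mul _ hw hF]
  calc
    _ = ∫⁻ g, ∫⁻ t in Set.Ioi (1:ℝ), F g * ∏ i, gammaPDF 1 1 ((t • g) i) := by
      refine lintegral_congr_ae ?_
      filter_upwards [hne] with g hg
      have hwt : Measurable fun t : ℝ => ∏ i, gammaPDF 1 1 ((t • g) i) :=
        hws.comp measurable_prodMk_left
      rw [lintegral_const_mul _ hwt,
        lintegral_Ioi_prod_gammaPDF_smul fun h =>
          Finset.sum_pos (fun i _ => (h i).lt_of_ne' (hg i)) Finset.univ_nonempty]
      simp only [Pi.mul_apply]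
      ring
    _ = ∫⁻ t in Set.Ioi (1:ℝ), ∫⁻ g, F g * ∏ i, gammaPDF 1 1 ((t • g) i) :=
      lintegral_lintegral_swap ((hF.comp measurable_fst).mul hws).aemeasurable
    _ = ∫⁻ t in Set.Ioi (1:ℝ), ENNReal.ofReal (t⁻¹ * (t ^ n)⁻¹) *
          ∫⁻ g, ((fun g : Fin n → ℝ => ∏ i, gammaPDF 1 1 (g i)) * F) g := by
      refine setLIntegral_congr_fun measurableSet_Ioi fun t ht => ?_
      have ht0 : (0:ℝ) < t := zero_lt_one.trans ht
      rw [ENNReal.ofReal_mul (inv_pos.2 ht0).le, mul_assoc,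
        ← lintegral_comp_smul_pi _ (hw.mul hF) ht0,
        ← lintegral_const_mul' _ _ ENNReal.ofReal_ne_top]
      refine lintegral_congr fun g => ?_
      rw [Pi.mul_apply, hhom t g ht0, mul_left_comm, ← mul_assoc (ENNReal.ofReal t⁻¹),
        ← ENNReal.ofReal_mul (inv_pos.2 ht0).le, inv_mul_cancel₀ ht0.ne', ENNReal.ofReal_one,
        one_mul, mul_comm]
    _ = _ := by
      rw [lintegral_mul_const _ (by fun_prop), lintegral_Ioi_inv_pow hn]

theorem lintegral_unitInterval_mul_split {φ ψ : ℝ → ℝ≥0∞} (hφ : Measurable φ)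
    (hψ : Measurable ψ) (hφ0 : ∀ x < 0, φ x = 0) (hψ0 : ∀ x < 0, ψ x = 0) :
    ∫⁻ u in Set.Ioo (0:ℝ) 1, ∫⁻ y, ENNReal.ofReal y * (φ (u * y) * ψ ((1 - u) * y)) =
      (∫⁻ x, φ x) * ∫⁻ y, ψ y := by
  calc
    _ = ∫⁻ u, ∫⁻ y, ENNReal.ofReal y * (φ (u * y) * ψ ((1 - u) * y)) := by
      rw [Measure.restrict_congr_set Ioo_ae_eq_Icc, ← lintegral_indicator measurableSet_Icc]
      refine lintegral_congr fun u => ?_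
      by_cases hu : u ∈ Set.Icc (0:ℝ) 1
      · rw [Set.indicator_of_mem hu]
      · rw [Set.indicator_of_notMem hu, eq_comm]
        refine (lintegral_congr fun y => ?_).trans lintegral_zero
        rcases le_or_gt y 0 with hy | hy
        · rw [ENNReal.ofReal_of_nonpos hy, zero_mul]
        · rcases lt_or_ge u 0 with h | h
          · rw [hφ0 _ (mul_neg_of_neg_of_pos h hy), zero_mul, mul_zero]
          · have h1 : 1 - u < 0 := sub_neg.2 (not_le.1 fun h1 => hu ⟨h, h1⟩)
            rw [hψ0 _ (mul_neg_of_neg_of_pos h1 hy), mul_zero, mul_zero]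
    _ = ∫⁻ y, ∫⁻ u, ENNReal.ofReal y * (φ (u * y) * ψ ((1 - u) * y)) :=
      lintegral_lintegral_swap (by fun_prop)
    _ = ∫⁻ y, ∫⁻ x, φ x * ψ (y - x) := by
      refine lintegral_congr_ae ?_
      filter_upwards [Measure.ae_ne volume (0:ℝ)] with y hy
      rcases hy.lt_or_gt with hy | hy
      · simp only [ENNReal.ofReal_of_nonpos hy.le, zero_mul, lintegral_zero]
        refine ((lintegral_congr fun x => ?_).trans lintegral_zero).symm
        rcases lt_or_ge x 0 with h | h
        · rw [hφ0 _ h, zero_mul]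
        · rw [hψ0 _ (by linarith), mul_zero]
      · rw [lintegral_const_mul _ (by fun_prop)]
        conv_rhs => rw [← Real.smul_map_volume_mul_right hy.ne']
        rw [lintegral_smul_measure, lintegral_map (by fun_prop) (by fun_prop), abs_of_pos hy]
        simp only [sub_mul, one_mul, smul_eq_mul]
    _ = ∫⁻ x, ∫⁻ y, φ x * ψ (y - x) := lintegral_lintegral_swap (by fun_prop)
    _ = _ := by
      rw [← lintegral_mul_const _ hφ]
      refine lintegral_congr fun x => ?_
      rw [lintegral_const_mul _ (by fun_prop), lintegral_sub_right_eq_self ψ x]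

theorem gammaPDF_one_one_split {u : ℝ} (hu : u ∈ Set.Ioo (0:ℝ) 1) (y : ℝ) :
    gammaPDF 1 1 (u * y) * gammaPDF 1 1 ((1 - u) * y) = gammaPDF 1 1 y := by
  rcases lt_or_ge y 0 with hy | hy
  · rw [gammaPDF_of_neg hy, gammaPDF_of_neg (mul_neg_of_pos_of_neg hu.1 hy), zero_mul]
  · simp only [gammaPDF_one_one]
    rw [if_pos hy, if_pos (mul_nonneg hu.1.le hy), if_pos (mul_nonneg (sub_pos.2 hu.2).le hy),
      ← ENNReal.ofReal_mul (exp_pos _).le, ← exp_add]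
    ring_nf

theorem lintegral_gammaMeasure_two_split {s t : Set ℝ} (hs : MeasurableSet s)
    (ht : MeasurableSet t) :
    ∫⁻ u in Set.Ioo (0:ℝ) 1, gammaMeasure 2 1 {y | u * y ∈ s ∧ (1 - u) * y ∈ t} =
      gammaMeasure 1 1 s * gammaMeasure 1 1 t := by
  have hp := measurable_gammaPDF 1 1
  rw [gammaMeasure_two_one, gammaMeasure, withDensity_apply _ hs, withDensity_apply _ ht,
    ← lintegral_indicator hs, ← lintegral_indicator ht,
    ← lintegral_unitInterval_mul_split (hp.indicator hs) (hp.indicator ht)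
      (fun x hx => by simp [Set.indicator, gammaPDF_of_neg hx])
      (fun x hx => by simp [Set.indicator, gammaPDF_of_neg hx])]
  refine setLIntegral_congr_fun measurableSet_Ioo fun u hu => ?_
  have hst : MeasurableSet {y | u * y ∈ s ∧ (1 - u) * y ∈ t} :=
    (measurable_const_mul u hs).inter (measurable_const_mul (1 - u) ht)
  rw [withDensity_apply _ hst, ← lintegral_indicator hst,
    lintegral_withDensity_eq_lintegral_mul _ hp (ENNReal.measurable_ofReal.indicator hst)]
  refine lintegral_congr fun y => ?_
  rw [Pi.mul_apply, ← gammaPDF_one_one_split hu y]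
  by_cases h1 : u * y ∈ s <;> by_cases h2 : (1 - u) * y ∈ t <;> simp [Set.indicator, h1, h2]
  exact mul_comm _ _

/-- Splits the `j`-th coordinate of `x` into two adjacent coordinates in proportions
`u` and `1 - u`. -/
def splitCoord {n : ℕ} (j : Fin n) (q : ℝ × (Fin n → ℝ)) : Fin (n + 1) → ℝ :=
  Fin.insertNth j.succ ((1 - q.1) * q.2 j) (Function.update q.2 j (q.1 * q.2 j))

theorem splitCoord_succ {n : ℕ} (j : Fin n) (q : ℝ × (Fin n → ℝ)) :
    splitCoord j q j.succ = (1 - q.1) * q.2 j :=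
  Fin.insertNth_apply_same (α := fun _ => ℝ) _ _ _

theorem splitCoord_succAbove {n : ℕ} (j : Fin n) (q : ℝ × (Fin n → ℝ)) (k : Fin n) :
    splitCoord j q (j.succ.succAbove k) = Function.update q.2 j (q.1 * q.2 j) k :=
  Fin.insertNth_apply_succAbove (α := fun _ => ℝ) _ _ _ _

theorem measurable_splitCoord {n : ℕ} (j : Fin n) : Measurable (splitCoord j) := by
  refine measurable_pi_iff.2 (Fin.forall_iff_succAbove j.succ |>.2 ⟨?_, fun k => ?_⟩)
  · simp only [splitCoord_succ]
    fun_prop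
  · simp only [splitCoord_succAbove]
    rcases eq_or_ne k j with rfl | hk
    · simp only [Function.update_self]
      fun_prop
    · simp only [Function.update_of_ne hk]
      fun_prop

theorem sum_splitCoord {n : ℕ} (j : Fin n) (q : ℝ × (Fin n → ℝ)) :
    ∑ i, splitCoord j q i = ∑ i, q.2 i := by
  rw [Fin.sum_univ_succAbove _ j.succ]
  simp only [splitCoord_succ, splitCoord_succAbove]
  rw [Finset.sum_update_of_mem (Finset.mem_univ j),
    ← Finset.add_sum_erase _ q.2 (Finset.mem_univ j), Finset.sdiff_singleton_eq_erase]
  ring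

theorem splitCoord_div {n : ℕ} (j : Fin n) (u c : ℝ) (g : Fin n → ℝ) :
    splitCoord j (u, fun i => g i / c) = fun i => splitCoord j (u, g) i / c := by
  refine funext (Fin.forall_iff_succAbove j.succ |>.2 ⟨?_, fun k => ?_⟩)
  · simp only [splitCoord_succ]
    ring
  · simp only [splitCoord_succAbove]
    rcases eq_or_ne k j with rfl | hk
    · simp only [Function.update_self]
      ring
    · simp only [Function.update_of_ne hk]

theorem map_splitCoord_pi_gammaMeasure {n : ℕ} (j : Fin n) :
    Measure.map (splitCoord j) ((volume.restrict (Set.Ioo (0:ℝ) 1)).prod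
      (Measure.pi fun i => gammaMeasure (Function.update (fun _ : Fin n => (1:ℝ)) j 2 i) 1)) =
      Measure.pi fun _ : Fin (n + 1) => gammaMeasure 1 1 := by
  have := isProbabilityMeasure_gammaMeasure_update j
  refine (Measure.pi_eq fun s hs => ?_).symm
  rw [Measure.map_apply (measurable_splitCoord j) (MeasurableSet.univ_pi hs),
    Measure.prod_apply (measurable_splitCoord j (MeasurableSet.univ_pi hs))]
  have hset : ∀ u : ℝ, Prod.mk u ⁻¹' (splitCoord j ⁻¹' Set.univ.pi s) =
      Set.univ.pi (Function.update (fun k => s (j.succ.succAbove k)) j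
        {y | u * y ∈ s (j.succ.succAbove j) ∧ (1 - u) * y ∈ s j.succ}) := by
    intro u
    ext g
    simp only [Set.mem_preimage, Set.mem_univ_pi, Fin.forall_iff_succAbove j.succ,
      splitCoord_succ, splitCoord_succAbove]
    constructor
    · rintro ⟨h1, h2⟩ k
      rcases eq_or_ne k j with rfl | hk
      · simpa [h1] using h2 k
      · simpa [hk] using h2 k
    · intro h
      have hj := h j
      rw [Function.update_self] at hj
      refine ⟨hj.2, fun k => ?_⟩
      rcases eq_or_ne k j with rfl | hk
      · simpa using hj.1
      · simpa [hk] using h k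
  have hprod : ∀ u : ℝ, Measure.pi
      (fun i => gammaMeasure (Function.update (fun _ : Fin n => (1:ℝ)) j 2 i) 1)
        (Prod.mk u ⁻¹' (splitCoord j ⁻¹' Set.univ.pi s)) =
      gammaMeasure 2 1 {y | u * y ∈ s (j.succ.succAbove j) ∧ (1 - u) * y ∈ s j.succ} *
        ∏ k ∈ Finset.univ.erase j, gammaMeasure 1 1 (s (j.succ.succAbove k)) := by
    intro u
    rw [hset, Measure.pi_pi, ← Finset.mul_prod_erase _ _ (Finset.mem_univ j)]
    simp only [Function.update_self]
    congr 1
    refine Finset.prod_congr rfl fun k hk => ?_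
    simp [Finset.ne_of_mem_erase hk]
  simp only [hprod]
  rw [lintegral_mul_const'' _ ?_, lintegral_gammaMeasure_two_split (hs _) (hs _),
    Fin.prod_univ_succAbove _ j.succ,
    ← Finset.mul_prod_erase _ (fun k => gammaMeasure 1 1 (s (j.succ.succAbove k)))
      (Finset.mem_univ j)]
  · ring
  · have : IsProbabilityMeasure (gammaMeasure 2 1) :=
      isProbabilityMeasure_gammaMeasure two_pos one_pos
    have hm : MeasurableSet {q : ℝ × ℝ | q.1 * q.2 ∈ s (j.succ.succAbove j) ∧
        (1 - q.1) * q.2 ∈ s j.succ} :=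
      ((measurable_fst.mul measurable_snd) (hs _)).inter
        (((measurable_fst.const_sub 1).mul measurable_snd) (hs _))
    exact (measurable_measure_prodMk_left hm).aemeasurable

theorem measurable_div_sum {n : ℕ} :
    Measurable fun (g : Fin n → ℝ) i => g i / ∑ j, g j := by
  fun_prop

theorem map_splitCoord_dirichletMeasure {n : ℕ} (j : Fin n) :
    Measure.map (splitCoord j) ((volume.restrict (Set.Ioo (0:ℝ) 1)).prod
      (dirichletMeasure (Function.update (fun _ : Fin n => (1:ℝ)) j 2))) =
      dirichletMeasure fun _ : Fin (n + 1) => 1 := by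
  have := isProbabilityMeasure_gammaMeasure_update j
  have h := Measure.map_prod_map (volume.restrict (Set.Ioo (0:ℝ) 1))
    (Measure.pi fun i => gammaMeasure (Function.update (fun _ : Fin n => (1:ℝ)) j 2 i) 1)
    measurable_id measurable_div_sum
  rw [Measure.map_id] at h
  rw [dirichletMeasure, dirichletMeasure, h, ← map_splitCoord_pi_gammaMeasure j,
    Measure.map_map (measurable_splitCoord j) (measurable_id.prodMap measurable_div_sum),
    Measure.map_map measurable_div_sum (measurable_splitCoord j)]
  congr 1
  ext q : 1
  simp only [Function.comp_apply, sum_splitCoord]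
  exact splitCoord_div j q.1 _ q.2

theorem setLIntegral_dirichletMeasure_one {n : ℕ} (hn : 0 < n) (j : Fin n)
    {A : Set (Fin n → ℝ)} (hA : MeasurableSet A) :
    ∫⁻ x in A, ENNReal.ofReal (x j) ∂(dirichletMeasure fun _ : Fin n => 1) =
      (n : ℝ≥0∞)⁻¹ * dirichletMeasure (Function.update (fun _ : Fin n => (1:ℝ)) j 2) A := by
  have hA' := measurable_div_sum hA
  have hf : Measurable fun g : Fin n → ℝ => ENNReal.ofReal (g j) := by fun_prop
  have hhom : ∀ (t : ℝ) (g : Fin n → ℝ), 0 < t →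
      ((fun (g : Fin n → ℝ) i => g i / ∑ j, g j) ⁻¹' A).indicator
        (fun g => ENNReal.ofReal (g j)) (t • g) = ENNReal.ofReal t *
      ((fun (g : Fin n → ℝ) i => g i / ∑ j, g j) ⁻¹' A).indicator
        (fun g => ENNReal.ofReal (g j)) g := by
    intro t g ht
    have h : (fun i => (t • g) i / ∑ j, (t • g) j) = fun i => g i / ∑ j, g j := by
      ext i
      simp only [Pi.smul_apply, smul_eq_mul, ← Finset.mul_sum, mul_div_mul_left _ _ ht.ne']
    have hmem : t • g ∈ (fun (g : Fin n → ℝ) i => g i / ∑ j, g j) ⁻¹' A ↔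
        g ∈ (fun (g : Fin n → ℝ) i => g i / ∑ j, g j) ⁻¹' A := by
      simp only [Set.mem_preimage, h]
    by_cases hg : g ∈ (fun (g : Fin n → ℝ) i => g i / ∑ j, g j) ⁻¹' A
    · rw [Set.indicator_of_mem hg, Set.indicator_of_mem (hmem.2 hg), Pi.smul_apply, smul_eq_mul,
        ENNReal.ofReal_mul ht.le]
    · rw [Set.indicator_of_notMem hg, Set.indicator_of_notMem (mt hmem.1 hg), mul_zero]
  have : Nonempty (Fin n) := ⟨j⟩
  rw [dirichletMeasure, dirichletMeasure, setLIntegral_map hA (by fun_prop) measurable_div_sum,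
    Measure.map_apply measurable_div_sum hA, pi_gammaMeasure_update_two,
    withDensity_apply _ hA', ← lintegral_indicator hA', ← lintegral_indicator hA',
    ← lintegral_div_sum_of_homogeneous hn (hf.indicator hA') hhom]
  refine lintegral_congr_ae ?_
  filter_upwards [ae_pos_pi_gammaMeasure_one] with g hg
  have hS : 0 < ∑ i, g i := Finset.sum_pos (fun i _ => hg i) Finset.univ_nonempty
  simp only [Set.indicator]
  split_ifs
  · rw [ENNReal.ofReal_div_of_pos hS, div_eq_mul_inv]
  · simp

theorem isProbabilityMeasure_dirichletMeasure {n : ℕ} {a : Fin n → ℝ} (ha : ∀ i, 0 < a i) :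
    IsProbabilityMeasure (dirichletMeasure a) := by
  have := fun i => isProbabilityMeasure_gammaMeasure (ha i) one_pos
  exact Measure.isProbabilityMeasure_map measurable_div_sum.aemeasurable

/-- size-biased index for a `Dir(1,…,1)` vector.
`(X₁,…,Xₙ) ~ Dir(1,…,1)` and `J` satisfies `P(J = j | X₁,…,Xₙ) = X_j` (encoded via
`P({J = j} ∩ X⁻¹ A) = ∫ X_j` over `X⁻¹ A` for every measurable `A`). Then:
(i) `P(J = j) = 1/n`;
(ii) conditioned on `{J = j}`, `(X₁,…,Xₙ) ~ Dir(1,…,1,2,1,…,1)` with the `2` in coordinate `j`;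
(iii) if `U ~ Uniform(0,1)` is independent of `(X, J)`, then conditioned on `{J = j}`,
`(X₁,…,X_{j−1}, U·X_j, (1−U)·X_j, X_{j+1},…,Xₙ) ~ Dir(1,…,1)` in dimension `n+1`. -/
theorem dirichlet_size_biased_index {Ω : Type*} [MeasurableSpace Ω] (P : Measure Ω)
    [IsProbabilityMeasure P] (n : ℕ) (hn : 0 < n)
    (X : Ω → Fin n → ℝ) (J : Ω → Fin n) (U : Ω → ℝ)
    (hX : Measurable X) (hJ : Measurable J) (hU : Measurable U)
    (hXlaw : Measure.map X P = dirichletMeasure (fun _ : Fin n => 1))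
    (hJcond : ∀ (j : Fin n) (A : Set (Fin n → ℝ)), MeasurableSet A →
      P ({ω | J ω = j} ∩ X ⁻¹' A) = ∫⁻ ω in X ⁻¹' A, ENNReal.ofReal (X ω j) ∂P)
    (hUlaw : Measure.map U P = volume.restrict (Set.Ioo (0:ℝ) 1))
    (hUindep : IndepFun U (fun ω => (X ω, J ω)) P) :
    (∀ j : Fin n, P {ω | J ω = j} = (n : ℝ≥0∞)⁻¹)
    ∧ (∀ j : Fin n, Measure.map X (P[|{ω | J ω = j}])
        = dirichletMeasure (Function.update (fun _ : Fin n => (1:ℝ)) j 2))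
    ∧ (∀ j : Fin n, Measure.map
        (fun ω => Fin.insertNth j.succ ((1 - U ω) * X ω j)
          (Function.update (X ω) j (U ω * X ω j))) (P[|{ω | J ω = j}])
        = dirichletMeasure (fun _ : Fin (n + 1) => 1)) := by
  have hJm : ∀ j, MeasurableSet {ω | J ω = j} := fun j => hJ (measurableSet_singleton j)
  have hn0 : (n : ℝ≥0∞) ≠ 0 := by exact_mod_cast hn.ne'
  have hjoint : ∀ (j : Fin n) (A : Set (Fin n → ℝ)), MeasurableSet A →
      P ({ω | J ω = j} ∩ X ⁻¹' A) =
        (n : ℝ≥0∞)⁻¹ * dirichletMeasure (Function.update (fun _ : Fin n => (1:ℝ)) j 2) A := by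
    intro j A hA
    rw [hJcond j A hA, ← setLIntegral_dirichletMeasure_one hn j hA, ← hXlaw,
      setLIntegral_map hA (by fun_prop) hX]
  have hdir : ∀ j : Fin n, IsProbabilityMeasure
      (dirichletMeasure (Function.update (fun _ : Fin n => (1:ℝ)) j 2)) := fun j =>
    isProbabilityMeasure_dirichletMeasure fun i => by
      rcases eq_or_ne i j with rfl | hi <;> simp [*]
  have hPJ : ∀ j : Fin n, P {ω | J ω = j} = (n : ℝ≥0∞)⁻¹ := by
    intro j
    simpa using hjoint j Set.univ MeasurableSet.univ
  refine ⟨hPJ, fun j => ?_, fun j => ?_⟩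
  · ext A hA
    rw [Measure.map_apply hX hA, cond_apply (hJm j), hjoint j A hA, hPJ j, ← mul_assoc, inv_inv,
      ENNReal.mul_inv_cancel hn0 (ENNReal.natCast_ne_top n), one_mul]
  · have hUX : Measure.map (fun ω => (U ω, X ω)) (P[|{ω | J ω = j}]) =
        (volume.restrict (Set.Ioo (0:ℝ) 1)).prod
          (dirichletMeasure (Function.update (fun _ : Fin n => (1:ℝ)) j 2)) := by
      refine (Measure.prod_eq fun B A hB hA => ?_).symm
      have hset : {ω | J ω = j} ∩ (fun ω => (U ω, X ω)) ⁻¹' B ×ˢ A =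
          U ⁻¹' B ∩ (fun ω => (X ω, J ω)) ⁻¹' A ×ˢ {j} := by
        ext ω
        simp only [Set.mem_inter_iff, Set.mem_ofPred_eq, Set.mem_preimage, Set.mem_prod,
          Set.mem_singleton_iff]
        tauto
      have hset' : (fun ω => (X ω, J ω)) ⁻¹' A ×ˢ {j} = {ω | J ω = j} ∩ X ⁻¹' A := by
        ext ω
        simp [and_comm]
      rw [Measure.map_apply (hU.prodMk hX) (hB.prod hA), cond_apply (hJm j), hset,
        hUindep.measure_inter_preimage_eq_mul _ _ hB (hA.prod (measurableSet_singleton j)),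
        hset', hjoint j A hA, hPJ j, inv_inv, ← hUlaw, Measure.map_apply hU hB,
        mul_left_comm (P _), ← mul_assoc, ENNReal.mul_inv_cancel hn0 (ENNReal.natCast_ne_top n),
        one_mul]
    rw [← map_splitCoord_dirichletMeasure j, ← hUX,
      Measure.map_map (measurable_splitCoord j) (hU.prodMk hX)]
    rfl
end

section
/- For every positive integer p there is a constant c = c(p,ℓ) > 0 such that for all positive integers k, n with n ≥ kℓ: E[ U_k(n)^p ] ≤ c (n/k)^{pℓ/(ℓ+1)}. -/
open MeasureTheory ProbabilityTheory Real
open scoped ENNReal NNReal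

/-- We regard the (countable) space of urn compositions as a discrete measurable space. -/
instance : MeasurableSpace (ℕ →₀ ℕ) := ⊤

/-- One step of the infinite-colors Pólya urn with immigration, at time `n`: a ball is picked
uniformly at random (a ball of color `c` with probability `s c / total`) and returned with an
extra ball of the same color; if `ℓ ∣ n`, a ball of the brand-new color `n/ℓ + 1` is added. -/
noncomputable def urnStep (ℓ n : ℕ) (s : ℕ →₀ ℕ) : Measure (ℕ →₀ ℕ) :=
  Measure.sum fun c : ℕ =>
    ((s c : ℝ≥0∞) / ∑' d : ℕ, (s d : ℝ≥0∞)) •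
      Measure.dirac
        (if ℓ ∣ n then s + Finsupp.single c 1 + Finsupp.single (n / ℓ + 1) 1
         else s + Finsupp.single c 1)

/-- The law of the composition of the infinite-colors Pólya urn with immigration after `n`
steps; at time `0` the urn contains a single ball of color `1`. The value `s k` of the
composition `s` is the number `U_k(n)` of balls of color `k`. -/
noncomputable def urnMeasure (ℓ : ℕ) : ℕ → Measure (ℕ →₀ ℕ)
  | 0 => Measure.dirac (Finsupp.single 1 1)
  | n + 1 => (urnMeasure ℓ n).bind (urnStep ℓ (n + 1))

instance : DiscreteMeasurableSpace (ℕ →₀ ℕ) := ⟨fun _ => trivial⟩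

/-- The composition of the urn after step `n`, if a ball of color `c` is drawn from `s`. -/
noncomputable def urnNext (ℓ n : ℕ) (s : ℕ →₀ ℕ) (c : ℕ) : ℕ →₀ ℕ :=
  if ℓ ∣ n then s + Finsupp.single c 1 + Finsupp.single (n / ℓ + 1) 1
  else s + Finsupp.single c 1

theorem lintegral_urnStep (ℓ n : ℕ) (s : ℕ →₀ ℕ) (f : (ℕ →₀ ℕ) → ℝ≥0∞) :
    ∫⁻ x, f x ∂(urnStep ℓ n s) =
      ∑' c : ℕ, (s c : ℝ≥0∞) / (∑' d : ℕ, (s d : ℝ≥0∞)) * f (urnNext ℓ n s c) := by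
  simp only [urnStep, lintegral_sum_measure, lintegral_smul_measure, lintegral_dirac, urnNext,
    smul_eq_mul]

theorem ae_urnStep_of_forall {ℓ n : ℕ} {s : ℕ →₀ ℕ} {P : (ℕ →₀ ℕ) → Prop}
    (h : ∀ c, s c ≠ 0 → P (urnNext ℓ n s c)) : ∀ᵐ x ∂(urnStep ℓ n s), P x := by
  rw [urnStep, Measure.ae_sum_iff]
  intro c
  by_cases hc : s c = 0
  · simp [hc]
  · refine Measure.ae_smul_measure ?_ _
    rw [ae_dirac_eq]
    exact h c hc

theorem lintegral_urnMeasure_succ (ℓ n : ℕ) (f : (ℕ →₀ ℕ) → ℝ≥0∞) :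
    ∫⁻ x, f x ∂(urnMeasure ℓ (n + 1)) =
      ∫⁻ s, ∫⁻ x, f x ∂(urnStep ℓ (n + 1) s) ∂(urnMeasure ℓ n) := by
  rw [urnMeasure, Measure.lintegral_bind Measurable.of_discrete.aemeasurable
    Measurable.of_discrete.aemeasurable]

theorem ae_urnMeasure_succ {ℓ n : ℕ} {P Q : (ℕ →₀ ℕ) → Prop}
    (hP : ∀ᵐ s ∂(urnMeasure ℓ n), P s)
    (h : ∀ s, P s → ∀ c, s c ≠ 0 → Q (urnNext ℓ (n + 1) s c)) :
    ∀ᵐ s ∂(urnMeasure ℓ (n + 1)), Q s := by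
  rw [ae_iff, urnMeasure, Measure.bind_apply (MeasurableSet.of_discrete)
    Measurable.of_discrete.aemeasurable, lintegral_eq_zero_iff Measurable.of_discrete]
  filter_upwards [hP] with s hs
  exact ae_iff.1 (ae_urnStep_of_forall (h s hs))

theorem tsum_single_one (c : ℕ) : ∑' d : ℕ, ((Finsupp.single c 1 d : ℕ) : ℝ≥0∞) = 1 := by
  rw [tsum_eq_single c]
  · simp
  · intro d hd
    simp [Finsupp.single_eq_of_ne hd]

theorem tsum_urnNext (ℓ n : ℕ) (s : ℕ →₀ ℕ) (c : ℕ) :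
    ∑' d : ℕ, ((urnNext ℓ n s c d : ℕ) : ℝ≥0∞) =
      (∑' d : ℕ, (s d : ℝ≥0∞)) + 1 + if ℓ ∣ n then 1 else 0 := by
  unfold urnNext
  split_ifs <;>
    simp [ENNReal.tsum_add, tsum_single_one]

theorem ae_tsum_urnMeasure (ℓ n : ℕ) :
    ∀ᵐ s ∂(urnMeasure ℓ n), ∑' d : ℕ, ((s d : ℕ) : ℝ≥0∞) = ((1 + n + n / ℓ : ℕ) : ℝ≥0∞) := by
  induction n with
  | zero =>
    rw [urnMeasure, ae_dirac_eq]
    simpa using tsum_single_one 1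
  | succ n ih =>
    refine ae_urnMeasure_succ ih fun s hs c _ => ?_
    rw [tsum_urnNext, hs, Nat.succ_div]
    split_ifs <;> push_cast <;> ring

theorem urnNext_apply_of_ne {ℓ n j : ℕ} (hn : n ≠ j * ℓ) (s : ℕ →₀ ℕ) (c : ℕ) :
    urnNext ℓ n s c (j + 1) = s (j + 1) + if c = j + 1 then 1 else 0 := by
  unfold urnNext
  split_ifs with h1 h2 h2
  · have : n / ℓ + 1 ≠ j + 1 := fun h => hn (by
      rw [← Nat.succ_injective h, Nat.div_mul_cancel h1])
    simp [h2, Finsupp.single_eq_of_ne this.symm]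
  · have : n / ℓ + 1 ≠ j + 1 := fun h => hn (by
      rw [← Nat.succ_injective h, Nat.div_mul_cancel h1])
    simp [Finsupp.single_eq_of_ne this.symm, Finsupp.single_eq_of_ne (Ne.symm h2)]
  · simp [h2]
  · simp [Finsupp.single_eq_of_ne (Ne.symm h2)]

theorem ae_apply_eq_zero_urnMeasure {ℓ j n : ℕ} (hn : n < j * ℓ) :
    ∀ᵐ s ∂(urnMeasure ℓ n), s (j + 1) = 0 := by
  induction n with
  | zero =>
    rw [urnMeasure, ae_dirac_eq]
    have : j ≠ 0 := by rintro rfl; simp at hn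
    exact Finsupp.single_eq_of_ne (by omega)
  | succ n ih =>
    refine ae_urnMeasure_succ (ih (by omega)) fun s hs c hc => ?_
    rw [urnNext_apply_of_ne hn.ne, hs, if_neg (by rintro rfl; exact hc hs)]

theorem ae_apply_eq_one_urnMeasure {ℓ : ℕ} (hℓ : 0 < ℓ) (j : ℕ) :
    ∀ᵐ s ∂(urnMeasure ℓ (j * ℓ)), s (j + 1) = 1 := by
  rcases Nat.eq_zero_or_pos j with rfl | hj
  · rw [Nat.zero_mul, urnMeasure, ae_dirac_eq]
    exact Finsupp.single_eq_same
  obtain ⟨n, hn⟩ := Nat.exists_eq_succ_of_ne_zero (Nat.mul_pos hj hℓ).ne'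
  rw [hn]
  refine ae_urnMeasure_succ (ae_apply_eq_zero_urnMeasure (hn ▸ n.lt_succ_self))
    fun s hs c hc => ?_
  have hcj : j + 1 ≠ c := by rintro rfl; exact hc hs
  rw [← Nat.succ_eq_add_one n, ← hn, urnNext, if_pos (Nat.dvd_mul_left ℓ j),
    Nat.mul_div_cancel _ hℓ]
  simp [hs, Finsupp.single_eq_of_ne hcj]

theorem lintegral_one_urnMeasure_le (ℓ n : ℕ) : ∫⁻ _, 1 ∂(urnMeasure ℓ n) ≤ 1 := by
  induction n with
  | zero => simp [urnMeasure]
  | succ n ih =>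
    rw [lintegral_urnMeasure_succ]
    refine (lintegral_mono fun s => ?_).trans ih
    rw [lintegral_urnStep]
    simp only [mul_one, div_eq_mul_inv, ENNReal.tsum_mul_right]
    exact ENNReal.div_self_le_one

/-- The rising factorial moment of order `p` of the number of balls of color `k`. -/
noncomputable def urnRisingMoment (ℓ p k n : ℕ) : ℝ≥0∞ :=
  ∫⁻ s, (((s k).ascFactorial p : ℕ) : ℝ≥0∞) ∂(urnMeasure ℓ n)

theorem urnRisingMoment_birth_le {ℓ : ℕ} (hℓ : 0 < ℓ) (p j : ℕ) :
    urnRisingMoment ℓ p (j + 1) (j * ℓ) ≤ (p.factorial : ℝ≥0∞) := by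
  have h : urnRisingMoment ℓ p (j + 1) (j * ℓ) =
      ∫⁻ _, (p.factorial : ℝ≥0∞) * 1 ∂(urnMeasure ℓ (j * ℓ)) := by
    refine lintegral_congr_ae ?_
    filter_upwards [ae_apply_eq_one_urnMeasure hℓ j] with s hs
    simp [hs, Nat.one_ascFactorial]
  rw [h, lintegral_const_mul _ measurable_const]
  exact mul_le_of_le_one_right' (lintegral_one_urnMeasure_le _ _)

theorem lintegral_urnStep_ascFactorial {ℓ n j t : ℕ} (p : ℕ) (hn : n ≠ j * ℓ) (ht : t ≠ 0)
    {s : ℕ →₀ ℕ} (hs : ∑' d : ℕ, ((s d : ℕ) : ℝ≥0∞) = (t : ℝ≥0∞)) :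
    ∫⁻ x, (((x (j + 1)).ascFactorial p : ℕ) : ℝ≥0∞) ∂(urnStep ℓ n s) =
      (1 + p / t : ℝ≥0∞) * (((s (j + 1)).ascFactorial p : ℕ) : ℝ≥0∞) := by
  set x := s (j + 1) with hx
  obtain ⟨D, hD⟩ := Nat.exists_eq_add_of_le (Nat.ascFactorial_le p x.le_succ)
  have hxD : x * D = p * x.ascFactorial p := by
    have := Nat.succ_ascFactorial x p
    rw [Nat.succ_eq_add_one, hD] at this
    linarith
  have hterm (c : ℕ) : (s c : ℝ≥0∞) / t *
        (((urnNext ℓ n s c (j + 1)).ascFactorial p : ℕ) : ℝ≥0∞) =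
      (s c : ℝ≥0∞) * ((t : ℝ≥0∞)⁻¹ * (x.ascFactorial p : ℕ)) +
        if c = j + 1 then (t : ℝ≥0∞)⁻¹ * ((x * D : ℕ) : ℝ≥0∞) else 0 := by
    rw [urnNext_apply_of_ne hn, div_eq_mul_inv]
    split_ifs with h
    · rw [← hx, hD, h, ← hx]
      push_cast
      ring
    · rw [add_zero, add_zero, ← hx]
      ring
  rw [lintegral_urnStep, hs]
  simp only [hterm]
  rw [ENNReal.tsum_add, ENNReal.tsum_mul_right, hs, tsum_ite_eq, ← mul_assoc,
    ENNReal.mul_inv_cancel (by exact_mod_cast ht) (ENNReal.natCast_ne_top t), hxD, div_eq_mul_inv]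
  push_cast
  ring

theorem urnRisingMoment_succ {ℓ j n : ℕ} (p : ℕ) (hn : j * ℓ ≤ n) :
    urnRisingMoment ℓ p (j + 1) (n + 1) =
      (1 + p / (1 + n + n / ℓ : ℕ) : ℝ≥0∞) * urnRisingMoment ℓ p (j + 1) n := by
  rw [urnRisingMoment, lintegral_urnMeasure_succ, urnRisingMoment,
    ← lintegral_const_mul _ Measurable.of_discrete]
  refine lintegral_congr_ae ?_
  filter_upwards [ae_tsum_urnMeasure ℓ n] with s hs
  exact lintegral_urnStep_ascFactorial p (by omega) (by positivity) hs

theorem urnRisingMoment_le_succ {ℓ j n : ℕ} (p : ℕ) (hn : j * ℓ ≤ n) :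
    urnRisingMoment ℓ p (j + 1) n ≤ urnRisingMoment ℓ p (j + 1) (n + 1) := by
  rw [urnRisingMoment_succ p hn]
  exact le_mul_of_one_le_left' le_self_add

theorem urnRisingMoment_add_le {ℓ : ℕ} (hℓ : 0 < ℓ) (p j m : ℕ) :
    urnRisingMoment ℓ p (j + 1) (j * ℓ + m) ≤ ((p.factorial * (1 + p) ^ m : ℕ) : ℝ≥0∞) := by
  induction m with
  | zero => simpa using urnRisingMoment_birth_le hℓ p j
  | succ m ih =>
    rw [← add_assoc, urnRisingMoment_succ p (Nat.le_add_right _ _), pow_succ, ← mul_assoc,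
      Nat.cast_mul, mul_comm]
    refine mul_le_mul' ih ?_
    push_cast
    gcongr
    refine ENNReal.div_le_of_le_mul (le_mul_of_one_le_right' ?_)
    rw [add_assoc]
    exact le_self_add

theorem one_add_div_le_rpow {ℓ p n : ℕ} (hℓ : 0 < ℓ) (hn : 0 < n) :
    1 + (p : ℝ) / ((1 + (n + 1) + (n + 1) / ℓ : ℕ) : ℝ) ≤
      (((n : ℝ) + 1) / n) ^ ((p : ℝ) * ℓ / (ℓ + 1)) := by
  have hn' : (0 : ℝ) < n := by exact_mod_cast hn
  have hℓ' : (0 : ℝ) < ℓ := by exact_mod_cast hℓ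
  have hT : ((n : ℝ) + 1) * (ℓ + 1) / ℓ ≤ ((1 + (n + 1) + (n + 1) / ℓ : ℕ) : ℝ) := by
    rw [div_le_iff₀ hℓ']
    have h : n + 1 < ((n + 1) / ℓ + 1) * ℓ := by
      rw [mul_comm]; exact Nat.lt_mul_div_succ _ hℓ
    have : (n + 1) * (ℓ + 1) ≤ (1 + (n + 1) + (n + 1) / ℓ) * ℓ := by
      calc (n + 1) * (ℓ + 1) = (n + 1) * ℓ + (n + 1) := by ring
        _ ≤ (n + 1) * ℓ + ((n + 1) / ℓ + 1) * ℓ := by omega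
        _ = _ := by ring
    exact_mod_cast this
  have hlog : 1 / ((n : ℝ) + 1) ≤ Real.log ((n + 1) / n) := by
    have := Real.one_sub_inv_le_log_of_pos (x := ((n : ℝ) + 1) / n) (by positivity)
    refine le_trans (le_of_eq ?_) this
    field_simp
    ring
  calc 1 + (p : ℝ) / ((1 + (n + 1) + (n + 1) / ℓ : ℕ) : ℝ)
      ≤ 1 + (p : ℝ) / (((n : ℝ) + 1) * (ℓ + 1) / ℓ) := by gcongr
    _ = 1 / ((n : ℝ) + 1) * ((p : ℝ) * ℓ / (ℓ + 1)) + 1 := by field_simp; ring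
    _ ≤ Real.log ((n + 1) / n) * ((p : ℝ) * ℓ / (ℓ + 1)) + 1 := by gcongr
    _ ≤ Real.exp (Real.log ((n + 1) / n) * ((p : ℝ) * ℓ / (ℓ + 1))) := Real.add_one_le_exp _
    _ = _ := (Real.rpow_def_of_pos (by positivity) _).symm

theorem urnRisingMoment_succ_le {ℓ : ℕ} (hℓ : 0 < ℓ) (p j : ℕ) {n : ℕ} (hn : (j + 1) * ℓ ≤ n) :
    urnRisingMoment ℓ p (j + 1) (n + 1) ≤
      ENNReal.ofReal (((p.factorial * (1 + p) ^ (ℓ + 1) : ℕ) : ℝ) *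
        ((n : ℝ) / ((j + 1 : ℕ) : ℝ)) ^ ((p : ℝ) * ℓ / (ℓ + 1))) := by
  induction n, hn using Nat.le_induction with
  | base =>
    have h := urnRisingMoment_add_le hℓ p j (ℓ + 1)
    rw [show j * ℓ + (ℓ + 1) = (j + 1) * ℓ + 1 by ring, ← ENNReal.ofReal_natCast] at h
    refine h.trans (ENNReal.ofReal_le_ofReal (le_mul_of_one_le_right (Nat.cast_nonneg _) ?_))
    refine Real.one_le_rpow ?_ (by positivity)
    rw [Nat.cast_mul, mul_div_cancel_left₀ _ (by positivity)]
    exact_mod_cast hℓ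
  | succ n hn ih =>
    have hn0 : 0 < n := (Nat.mul_pos j.succ_pos hℓ).trans_le hn
    have hfac : (1 + p / (1 + (n + 1) + (n + 1) / ℓ : ℕ) : ℝ≥0∞) ≤
        ENNReal.ofReal ((((n : ℝ) + 1) / n) ^ ((p : ℝ) * ℓ / (ℓ + 1))) := by
      refine le_trans (le_of_eq ?_) (ENNReal.ofReal_le_ofReal (one_add_div_le_rpow hℓ hn0))
      rw [ENNReal.ofReal_add zero_le_one (by positivity), ENNReal.ofReal_one,
        ENNReal.ofReal_div_of_pos (by positivity), ENNReal.ofReal_natCast,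
        ENNReal.ofReal_natCast]
    rw [urnRisingMoment_succ p (by nlinarith)]
    refine (mul_le_mul' hfac ih).trans (le_of_eq ?_)
    have hn' : (0 : ℝ) < n := by exact_mod_cast hn0
    rw [← ENNReal.ofReal_mul (by positivity), mul_left_comm,
      ← Real.mul_rpow (by positivity) (by positivity), div_mul_div_cancel₀ hn'.ne']
    push_cast
    rfl

/-- with `U_k(n)` the number of balls of color `k` in the infinite-colors Pólya
urn with immigration, for every positive integer `p` there is `c = c(p,ℓ) > 0` such that for
all positive integers `k, n` with `n ≥ kℓ`, `E[U_k(n)^p] ≤ c (n/k)^{pℓ/(ℓ+1)}`. -/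
theorem urn_Uk_moment_bound (ℓ : ℕ) (hℓ : 0 < ℓ) (p : ℕ) (hp : 0 < p) :
    ∃ c : ℝ, 0 < c ∧ ∀ k n : ℕ, 0 < k → 0 < n → k * ℓ ≤ n →
      (∫⁻ s, ((s k : ℕ) : ℝ≥0∞) ^ p ∂(urnMeasure ℓ n))
        ≤ ENNReal.ofReal (c * ((n : ℝ) / (k : ℝ)) ^ ((p : ℝ) * ℓ / (ℓ + 1))) := by
  refine ⟨((p.factorial * (1 + p) ^ (ℓ + 1) : ℕ) : ℝ), by positivity, fun k n hk _ hkn => ?_⟩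
  obtain ⟨j, rfl⟩ := Nat.exists_eq_succ_of_ne_zero hk.ne'
  calc ∫⁻ s, ((s (j + 1) : ℕ) : ℝ≥0∞) ^ p ∂(urnMeasure ℓ n)
      ≤ urnRisingMoment ℓ p (j + 1) n := lintegral_mono fun s => by
        rw [← Nat.cast_pow]
        exact Nat.cast_le.2 (Nat.pow_succ_le_ascFactorial _ _)
    _ ≤ urnRisingMoment ℓ p (j + 1) (n + 1) :=
        urnRisingMoment_le_succ p ((Nat.mul_le_mul_right ℓ j.le_succ).trans hkn)
    _ ≤ _ := urnRisingMoment_succ_le hℓ p j hkn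
end

section
/- For every non-negative integer p there exists a constant f_{p,ℓ} > 0, not depending on b, w, or t, such that for all positive integers b, w and all non-negative integers t: E[ W(t;b,w)^p ] ≤ f_{p,ℓ} w^p ( 1 + t/(α(b+w)) )^p ( 1 + log( 1 + t/(α(b+w)) ) ). -/
open MeasureTheory ProbabilityTheory Real
open scoped ENNReal NNReal

/-- One step of the two-color Pólya urn at time `t`, on states `(black, white)`: a ball is
chosen uniformly at random and returned together with one additional ball of the same color;
if `ℓ ∣ t` a second additional ball of the chosen color is added. -/
noncomputable def urn2Step (ℓ t : ℕ) (s : ℕ × ℕ) : Measure (ℕ × ℕ) :=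
  ((s.1 : ℝ≥0∞) / ((s.1 : ℝ≥0∞) + (s.2 : ℝ≥0∞))) •
      Measure.dirac (s.1 + (if ℓ ∣ t then 2 else 1), s.2)
    + ((s.2 : ℝ≥0∞) / ((s.1 : ℝ≥0∞) + (s.2 : ℝ≥0∞))) •
      Measure.dirac (s.1, s.2 + (if ℓ ∣ t then 2 else 1))

/-- The law of the two-color Pólya urn after `t` draws, started from `b` black and `w` white
balls; the second coordinate of the state is the number `W(t;b,w)` of white balls. -/
noncomputable def urn2Measure (ℓ b w : ℕ) : ℕ → Measure (ℕ × ℕ)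
  | 0 => Measure.dirac (b, w)
  | t + 1 => (urn2Measure ℓ b w t).bind (urn2Step ℓ (t + 1))

/-- The rising product `w (w + 2) ⋯ (w + 2 (p - 1))`. -/
def risingTwo (p w : ℕ) : ℕ := ∏ i ∈ Finset.range p, (w + 2 * i)

theorem pow_le_risingTwo (p w : ℕ) : w ^ p ≤ risingTwo p w := by
  unfold risingTwo
  calc w ^ p = ∏ _i ∈ Finset.range p, w := by simp
    _ ≤ _ := Finset.prod_le_prod' fun i _ => Nat.le_add_right _ _

theorem risingTwo_le (p : ℕ) {w : ℕ} (hw : 0 < w) :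
    risingTwo p w ≤ (1 + 2 * p) ^ p * w ^ p := by
  unfold risingTwo
  calc ∏ i ∈ Finset.range p, (w + 2 * i)
      ≤ ∏ _i ∈ Finset.range p, ((1 + 2 * p) * w) := by
        refine Finset.prod_le_prod' fun i hi => ?_
        have hi' : i < p := Finset.mem_range.1 hi
        nlinarith
    _ = _ := by simp [mul_pow]

theorem mul_risingTwo_add_le (p w : ℕ) {m : ℕ} (hm : m ≤ 2) :
    w * risingTwo p (w + m) ≤ (w + p * m) * risingTwo p w := by
  induction p with
  | zero => simp [risingTwo]
  | succ p ih =>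
    have hsucc : ∀ x, risingTwo (p + 1) x = risingTwo p x * (x + 2 * p) := fun x =>
      Finset.prod_range_succ _ _
    rw [hsucc, hsucc]
    calc w * (risingTwo p (w + m) * (w + m + 2 * p))
        = (w * risingTwo p (w + m)) * (w + m + 2 * p) := by ring
      _ ≤ ((w + p * m) * risingTwo p w) * (w + m + 2 * p) := by gcongr
      _ = ((w + p * m) * (w + m + 2 * p)) * risingTwo p w := by ring
      _ ≤ ((w + (p + 1) * m) * (w + 2 * p)) * risingTwo p w := by
        refine Nat.mul_le_mul_right _ ?_
        have h := Nat.mul_le_mul_left (p * m) hm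
        nlinarith
      _ = _ := by ring

/-- The mean of `risingTwo p` after one draw adding `m ≤ 2` balls grows by at most the
`p`-th power of the growth factor of the total. -/
theorem risingTwo_step_le (p : ℕ) {b w m : ℕ} (hm : m ≤ 2) (h : 0 < b + w) :
    (b : ℝ≥0∞) / ((b : ℝ≥0∞) + w) * risingTwo p w
        + (w : ℝ≥0∞) / ((b : ℝ≥0∞) + w) * risingTwo p (w + m)
      ≤ ENNReal.ofReal ((((b + w + m : ℕ) : ℝ) / ((b + w : ℕ) : ℝ)) ^ p) * risingTwo p w := by
  have hN : (0 : ℝ) < (b : ℝ) + w := by exact_mod_cast h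
  have key : (w : ℝ) * risingTwo p (w + m) ≤ ((w : ℝ) + p * m) * risingTwo p w := by
    exact_mod_cast mul_risingTwo_add_le p w hm
  have bern : 1 + (p : ℝ) * ((m : ℝ) / (b + w)) ≤ (1 + (m : ℝ) / (b + w)) ^ p :=
    one_add_mul_le_pow (le_trans (by norm_num) (by positivity : (0 : ℝ) ≤ (m : ℝ) / (b + w))) p
  have hreal : (b : ℝ) / ((b : ℝ) + w) * risingTwo p w
        + (w : ℝ) / ((b : ℝ) + w) * risingTwo p (w + m)
      ≤ (((b + w + m : ℕ) : ℝ) / ((b + w : ℕ) : ℝ)) ^ p * risingTwo p w := by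
    calc (b : ℝ) / ((b : ℝ) + w) * risingTwo p w
          + (w : ℝ) / ((b : ℝ) + w) * risingTwo p (w + m)
        = (b * risingTwo p w + w * risingTwo p (w + m)) / ((b : ℝ) + w) := by ring
      _ ≤ (b * risingTwo p w + ((w : ℝ) + p * m) * risingTwo p w) / ((b : ℝ) + w) := by gcongr
      _ = (1 + (p : ℝ) * ((m : ℝ) / (b + w))) * risingTwo p w := by field_simp; ring
      _ ≤ (1 + (m : ℝ) / (b + w)) ^ p * risingTwo p w := by gcongr
      _ = _ := by
        congr 2
        push_cast
        field_simp
  have hcast : ∀ k : ℕ, (k : ℝ≥0∞) = ENNReal.ofReal (k : ℝ) := fun k =>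
    (ENNReal.ofReal_natCast k).symm
  rw [hcast b, hcast w, hcast (risingTwo p w), hcast (risingTwo p (w + m)),
    ← ENNReal.ofReal_add (by positivity) (by positivity),
    ← ENNReal.ofReal_div_of_pos hN, ← ENNReal.ofReal_div_of_pos hN,
    ← ENNReal.ofReal_mul (by positivity), ← ENNReal.ofReal_mul (by positivity),
    ← ENNReal.ofReal_mul (by positivity), ← ENNReal.ofReal_add (by positivity) (by positivity)]
  exact ENNReal.ofReal_le_ofReal hreal

theorem lintegral_urn2Step (ℓ t : ℕ) (s : ℕ × ℕ) (f : ℕ × ℕ → ℝ≥0∞) :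
    ∫⁻ x, f x ∂(urn2Step ℓ t s)
      = (s.1 : ℝ≥0∞) / ((s.1 : ℝ≥0∞) + s.2) * f (s.1 + (if ℓ ∣ t then 2 else 1), s.2)
        + (s.2 : ℝ≥0∞) / ((s.1 : ℝ≥0∞) + s.2) * f (s.1, s.2 + (if ℓ ∣ t then 2 else 1)) := by
  rw [urn2Step, lintegral_add_measure, lintegral_smul_measure, lintegral_smul_measure,
    lintegral_dirac, lintegral_dirac]
  rfl

/-- The number of balls after `t` draws, starting from `n`. -/
def urn2Total (ℓ n t : ℕ) : ℕ := n + t + t / ℓ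

theorem urn2Total_succ (ℓ n t : ℕ) :
    urn2Total ℓ n (t + 1) = urn2Total ℓ n t + (if ℓ ∣ t + 1 then 2 else 1) := by
  unfold urn2Total
  rw [Nat.succ_div]
  split_ifs <;> omega

/-- Setting the test function to `⊤` off the states with the correct total also records that
the total number of balls is almost surely `urn2Total`. -/
theorem lintegral_risingTwo_urn2Measure_le (ℓ p : ℕ) {b w : ℕ} (h : 0 < b + w) (t : ℕ) :
    ∫⁻ s, (if s.1 + s.2 = urn2Total ℓ (b + w) t then (risingTwo p s.2 : ℝ≥0∞) else ⊤)
        ∂(urn2Measure ℓ b w t)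
      ≤ ENNReal.ofReal (((urn2Total ℓ (b + w) t : ℝ) / ((b + w : ℕ) : ℝ)) ^ p)
        * risingTwo p w := by
  induction t with
  | zero =>
    have hN : ((b + w : ℕ) : ℝ) ≠ 0 := by exact_mod_cast h.ne'
    rw [urn2Measure, lintegral_dirac]
    simp only [urn2Total, Nat.zero_div, add_zero, if_true, div_self hN, one_pow,
      ENNReal.ofReal_one, one_mul, le_refl]
  | succ t ih =>
    have hpos : 0 < urn2Total ℓ (b + w) t := Nat.add_pos_left (Nat.add_pos_left h _) _
    have hpos' : 0 < urn2Total ℓ (b + w) (t + 1) :=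
      Nat.add_pos_left (Nat.add_pos_left h _) _
    have hposR : (0 : ℝ) < urn2Total ℓ (b + w) t := by exact_mod_cast hpos
    have hposR' : (0 : ℝ) < urn2Total ℓ (b + w) (t + 1) := by exact_mod_cast hpos'
    set c : ℝ≥0∞ := ENNReal.ofReal
      (((urn2Total ℓ (b + w) (t + 1) : ℝ) / (urn2Total ℓ (b + w) t : ℝ)) ^ p) with hc
    have hc0 : c ≠ 0 := by
      rw [hc, Ne, ENNReal.ofReal_eq_zero, not_le]
      positivity
    rw [urn2Measure, Measure.lintegral_bind (Measurable.of_discrete).aemeasurable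
      (Measurable.of_discrete).aemeasurable]
    calc _ ≤ ∫⁻ s, c * (if s.1 + s.2 = urn2Total ℓ (b + w) t
              then (risingTwo p s.2 : ℝ≥0∞) else ⊤) ∂(urn2Measure ℓ b w t) := by
          refine lintegral_mono fun s => ?_
          dsimp only
          split_ifs with hs
          · have hm : (if ℓ ∣ t + 1 then 2 else 1) ≤ 2 := by split_ifs <;> omega
            have hs0 : 0 < s.1 + s.2 := hs ▸ hpos
            rw [lintegral_urn2Step]
            have h1 : s.1 + (if ℓ ∣ t + 1 then 2 else 1) + s.2
                = urn2Total ℓ (b + w) (t + 1) := by rw [urn2Total_succ, ← hs]; ring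
            have h2 : s.1 + (s.2 + (if ℓ ∣ t + 1 then 2 else 1))
                = urn2Total ℓ (b + w) (t + 1) := by rw [urn2Total_succ, ← hs]; ring
            rw [if_pos h1, if_pos h2, hc, urn2Total_succ, ← hs]
            exact risingTwo_step_le p hm hs0
          · rw [ENNReal.mul_top hc0]
            exact le_top
      _ = c * ∫⁻ s, (if s.1 + s.2 = urn2Total ℓ (b + w) t
              then (risingTwo p s.2 : ℝ≥0∞) else ⊤) ∂(urn2Measure ℓ b w t) :=
          lintegral_const_mul _ Measurable.of_discrete
      _ ≤ c * (ENNReal.ofReal (((urn2Total ℓ (b + w) t : ℝ) / ((b + w : ℕ) : ℝ)) ^ p)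
            * risingTwo p w) := by gcongr
      _ = _ := by
          rw [← mul_assoc, hc, ← ENNReal.ofReal_mul (by positivity), ← mul_pow,
            div_mul_div_cancel₀ hposR.ne']

theorem urn2Total_div_le (ℓ n t : ℕ) (hℓ : 0 < ℓ) (hn : 0 < n) :
    (urn2Total ℓ n t : ℝ) / n ≤ 1 + (t : ℝ) / ((ℓ : ℝ) / (ℓ + 1) * n) := by
  have hℓ' : (0 : ℝ) < ℓ := by exact_mod_cast hℓ
  have hn' : (0 : ℝ) < n := by exact_mod_cast hn
  have hd : ((t / ℓ : ℕ) : ℝ) ≤ (t : ℝ) / ℓ := Nat.cast_div_le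
  rw [div_le_iff₀ hn']
  calc (urn2Total ℓ n t : ℝ) = n + t + ((t / ℓ : ℕ) : ℝ) := by simp [urn2Total]
    _ ≤ n + t + (t : ℝ) / ℓ := by gcongr
    _ = _ := by field_simp; ring

/-- with `α = ℓ/(ℓ+1)`, for every non-negative integer `p` there exists a
constant `f = f_{p,ℓ} > 0`, not depending on `b, w, t`, such that for all positive integers
`b, w` and all `t ≥ 0`,
`E[W(t;b,w)^p] ≤ f w^p (1 + t/(α(b+w)))^p (1 + log(1 + t/(α(b+w))))`. -/
theorem urn2_white_moment_bound (ℓ : ℕ) (hℓ : 0 < ℓ) (α : ℝ) (hα : α = (ℓ : ℝ) / (ℓ + 1))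
    (p : ℕ) :
    ∃ f : ℝ, 0 < f ∧ ∀ b w : ℕ, 0 < b → 0 < w → ∀ t : ℕ,
      (∫⁻ s, ((s.2 : ℕ) : ℝ≥0∞) ^ p ∂(urn2Measure ℓ b w t))
        ≤ ENNReal.ofReal (f * (w : ℝ) ^ p * (1 + (t : ℝ) / (α * ((b : ℝ) + w))) ^ p
            * (1 + Real.log (1 + (t : ℝ) / (α * ((b : ℝ) + w))))) := by
  subst hα
  refine ⟨((1 + 2 * p : ℕ) : ℝ) ^ p, by positivity, fun b w hb hw t => ?_⟩
  have hℓ' : (0 : ℝ) < ℓ := by exact_mod_cast hℓ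
  have hb' : (0 : ℝ) < b := by exact_mod_cast hb
  have hw' : (0 : ℝ) < w := by exact_mod_cast hw
  have hx := urn2Total_div_le ℓ (b + w) t hℓ (by omega)
  push_cast at hx
  set x : ℝ := (t : ℝ) / ((ℓ : ℝ) / (ℓ + 1) * ((b : ℝ) + w)) with hxdef
  have hx0 : 0 ≤ x := by positivity
  have hlog : 0 ≤ Real.log (1 + x) := Real.log_nonneg (by linarith)
  calc (∫⁻ s, ((s.2 : ℕ) : ℝ≥0∞) ^ p ∂(urn2Measure ℓ b w t))
      ≤ ∫⁻ s, (if s.1 + s.2 = urn2Total ℓ (b + w) t then (risingTwo p s.2 : ℝ≥0∞) else ⊤)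
        ∂(urn2Measure ℓ b w t) := by
        refine lintegral_mono fun s => ?_
        dsimp only
        split_ifs
        · exact_mod_cast pow_le_risingTwo p s.2
        · exact le_top
    _ ≤ ENNReal.ofReal (((urn2Total ℓ (b + w) t : ℝ) / ((b + w : ℕ) : ℝ)) ^ p)
        * risingTwo p w := lintegral_risingTwo_urn2Measure_le ℓ p (by omega) t
    _ = ENNReal.ofReal (((urn2Total ℓ (b + w) t : ℝ) / ((b : ℝ) + w)) ^ p
        * risingTwo p w) := by
        rw [ENNReal.ofReal_mul (by positivity), ENNReal.ofReal_natCast, Nat.cast_add]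
    _ ≤ _ := by
        refine ENNReal.ofReal_le_ofReal ?_
        have hV : (risingTwo p w : ℝ) ≤ ((1 + 2 * p : ℕ) : ℝ) ^ p * (w : ℝ) ^ p := by
          exact_mod_cast risingTwo_le p hw
        calc _ ≤ (1 + x) ^ p * (((1 + 2 * p : ℕ) : ℝ) ^ p * (w : ℝ) ^ p) := by gcongr
          _ = ((1 + 2 * p : ℕ) : ℝ) ^ p * (w : ℝ) ^ p * (1 + x) ^ p := by ring
          _ ≤ _ := le_mul_of_one_le_right (by positivity) (by linarith)
end
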